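/- arXiv:2110.00985 — 4 statements merged into one kernel-verified Lean document; each statement's English description precedes it below -/
import Mathlib

section
/- Let T be an m×n column-stochastic matrix that is input symmetric with input symmetry group 𝒢ᵢ of order n. Then for every λ ∈ [0,1], the minimum of Σ_i v_i·φ(r_i) over all finite decompositions uₙ = Σ_i v_i·r_i of the uniform vector uₙ equals min_{p ∈ Δₙ} φ(p), where φ(p) = H(Tp) − λ·H(p). Moreover, the minimum is attained by a decomposition with uniform weights (1/n,…,1/n) whose components are the n permuted copies {G_α p*}_{α=1}^n of a minimizer p* of φ, i.e., the optimal test channel from W to X is a group-permutation (modulo-additive) channel with W uniform. -/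
open Matrix BigOperators

noncomputable section

/-- A probability vector: nonnegative entries summing to 1. -/
def probVec {n : ℕ} (p : Fin n → ℝ) : Prop := (∀ i, 0 ≤ p i) ∧ ∑ i, p i = 1

/-- A column-stochastic `m × n` matrix: nonnegative entries, each column sums to 1. -/
def colStochastic {m n : ℕ} (T : Matrix (Fin m) (Fin n) ℝ) : Prop :=
  (∀ j i, 0 ≤ T j i) ∧ ∀ i, ∑ j, T j i = 1

/-- Shannon entropy (`Real.log 0 = 0` gives the convention `0 · log 0 = 0`). -/
def ent {n : ℕ} (p : Fin n → ℝ) : ℝ := -∑ i, p i * Real.log (p i)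

/-- The functional `φ(p, λ) = H(Tp) − λ·H(p)`. -/
def phi {m n : ℕ} (T : Matrix (Fin m) (Fin n) ℝ) (lam : ℝ) (p : Fin n → ℝ) : ℝ :=
  ent (T.mulVec p) - lam * ent p

/-- Entropy is invariant under permuting the coordinates. -/
theorem ent_comp_perm {n : ℕ} (p : Fin n → ℝ) (σ : Equiv.Perm (Fin n)) :
    ent (p ∘ σ) = ent p := by
  unfold ent
  exact congrArg Neg.neg (Equiv.sum_comp σ fun i => p i * Real.log (p i))

theorem probVec.comp_perm {n : ℕ} {p : Fin n → ℝ} (hp : probVec p) (σ : Equiv.Perm (Fin n)) :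
    probVec (p ∘ σ) :=
  ⟨fun i => hp.1 (σ i), (Equiv.sum_comp σ p).trans hp.2⟩

/-- `φ` is invariant under the input symmetries of `T`. -/
theorem phi_permMatrix_mulVec {m n : ℕ} {T : Matrix (Fin m) (Fin n) ℝ}
    {σ : Equiv.Perm (Fin n)} {τ : Equiv.Perm (Fin m)}
    (h : T * σ.permMatrix ℝ = τ.permMatrix ℝ * T) (lam : ℝ) (p : Fin n → ℝ) :
    phi T lam ((σ.permMatrix ℝ).mulVec p) = phi T lam p := by
  unfold phi
  rw [Matrix.mulVec_mulVec, h, ← Matrix.mulVec_mulVec, Matrix.permMatrix_mulVec,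
    Matrix.permMatrix_mulVec, ent_comp_perm, ent_comp_perm]

/-- Averaging over a transitive family of `n` permutations sums over all coordinates. -/
theorem sum_apply_of_transitive {n : ℕ} {G : Fin n → Equiv.Perm (Fin n)}
    (hG : ∀ i j : Fin n, ∃ α : Fin n, G α i = j) (p : Fin n → ℝ) (i : Fin n) :
    ∑ α, p (G α i) = ∑ j, p j :=
  (Finite.surjective_iff_bijective.mp (hG i)).sum_comp p

/-- for an input symmetric `T` whose input symmetry group
`𝒢ᵢ = {G₁,…,Gₙ}` has order `n`, and λ ∈ [0,1], the minimum of `Σ_i v_i·φ(r_i)` over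
finite decompositions of the uniform vector `uₙ` equals `min_{p ∈ Δₙ} φ(p) = φ(p*)`.
It is attained by uniform weights `(1/n,…,1/n)` with the `n` permuted copies
`G_α p*` of a minimizer `p*` as components (a group-permutation test channel with
`W` uniform). -/
theorem stmt4 {m n : ℕ} (hn : 0 < n) (T : Matrix (Fin m) (Fin n) ℝ) (hT : colStochastic T)
    (G : Fin n → Equiv.Perm (Fin n)) (hGinj : Function.Injective G)
    (hGsym : ∀ α : Fin n,
      ∃ τ : Equiv.Perm (Fin m), T * (G α).permMatrix ℝ = τ.permMatrix ℝ * T)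
    (hGall : ∀ σ : Equiv.Perm (Fin n),
      (∃ τ : Equiv.Perm (Fin m), T * σ.permMatrix ℝ = τ.permMatrix ℝ * T) → ∃ α, σ = G α)
    (hGtrans : ∀ i j : Fin n, ∃ α : Fin n, G α i = j)
    (lam : ℝ) (hlam : lam ∈ Set.Icc (0 : ℝ) 1)
    (pstar : Fin n → ℝ) (hps : probVec pstar)
    (hmin : ∀ p : Fin n → ℝ, probVec p → phi T lam pstar ≤ phi T lam p) :
    (∀ (k : ℕ) (v : Fin k → ℝ) (r : Fin k → Fin n → ℝ),
      probVec v → (∀ i, probVec (r i)) →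
      (∑ i, v i • r i) = (fun _ : Fin n => (n : ℝ)⁻¹) →
      phi T lam pstar ≤ ∑ i, v i * phi T lam (r i)) ∧
    (∑ α : Fin n, (n : ℝ)⁻¹ • ((G α).permMatrix ℝ).mulVec pstar) =
      (fun _ : Fin n => (n : ℝ)⁻¹) ∧
    (∀ α : Fin n, probVec (((G α).permMatrix ℝ).mulVec pstar)) ∧
    (∑ α : Fin n, (n : ℝ)⁻¹ * phi T lam (((G α).permMatrix ℝ).mulVec pstar)) =
      phi T lam pstar := by
  refine ⟨fun k v r hv hr _ => ?_, ?_, fun α => ?_, ?_⟩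
  · calc phi T lam pstar = ∑ i, v i * phi T lam pstar := by
          rw [← Finset.sum_mul, hv.2, one_mul]
      _ ≤ ∑ i, v i * phi T lam (r i) :=
          Finset.sum_le_sum fun i _ => mul_le_mul_of_nonneg_left (hmin _ (hr i)) (hv.1 i)
  · funext i
    simp only [Matrix.permMatrix_mulVec, Finset.sum_apply, Pi.smul_apply, Function.comp_apply,
      smul_eq_mul]
    rw [← Finset.mul_sum, sum_apply_of_transitive hGtrans, hps.2, mul_one]
  · rw [Matrix.permMatrix_mulVec]
    exact hps.comp_perm (G α)
  · have hphi : ∀ α, phi T lam (((G α).permMatrix ℝ).mulVec pstar) = phi T lam pstar := fun α =>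
      (hGsym α).elim fun _ hτ => phi_permMatrix_mulVec hτ lam pstar
    have hn' : (n : ℝ) ≠ 0 := Nat.cast_ne_zero.mpr hn.ne'
    simp only [hphi, Finset.sum_const, Finset.card_univ, Fintype.card_fin, nsmul_eq_mul]
    rw [mul_inv_cancel_left₀ hn']
end
end

section
/- Let n ≥ 2, β ∈ [0,1], let e be any standard basis vector of ℝⁿ and v = β·e + (1−β)·uₙ. Then v is a probability vector and log n − H(v) = ((n−1)/n)·(1−β)·log(1−β) + ((βn + 1 − β)/n)·log(βn + 1 − β) =: gₙ(β), where H is the Shannon entropy and terms with argument 0 are interpreted as 0. -/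
open Matrix BigOperators

noncomputable section

/-- `gₙ(β) = ((n−1)/n)(1−β)log(1−β) + ((βn+1−β)/n)log(βn+1−β)`
(with `Real.log 0 = 0` giving the `0·log 0 = 0` convention). -/
def gfun (n : ℕ) (β : ℝ) : ℝ :=
  ((n - 1 : ℝ) / n) * (1 - β) * Real.log (1 - β) +
    ((β * n + 1 - β) / n) * Real.log (β * n + 1 - β)

/-- Summing a function over the entries of `β·e + (1−β)·uₙ`: one entry is `(βn+1−β)/n` and the
remaining `n − 1` entries are `(1−β)/n`. -/
theorem sum_comp_basis_add_uniform {n : ℕ} (F : ℝ → ℝ) (β : ℝ) (i₀ : Fin n) :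
    ∑ i, F ((β • (fun i => if i = i₀ then (1 : ℝ) else 0) +
      (1 - β) • fun _ => (n : ℝ)⁻¹ : Fin n → ℝ) i) =
      F ((β * n + 1 - β) / n) + (n - 1 : ℝ) * F ((1 - β) / n) := by
  have hpos : 0 < n := i₀.pos
  have hn0 : (n : ℝ) ≠ 0 := by positivity
  rw [← Finset.add_sum_erase _ _ (Finset.mem_univ i₀)]
  congr 1
  · simp only [Pi.add_apply, Pi.smul_apply, if_true, smul_eq_mul]
    congr 1
    field_simp
    ring
  · have h : ∀ i ∈ Finset.univ.erase i₀,
        F ((β • (fun i => if i = i₀ then (1 : ℝ) else 0) +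
          (1 - β) • fun _ => (n : ℝ)⁻¹ : Fin n → ℝ) i) = F ((1 - β) / n) := by
      intro i hi
      simp [Finset.ne_of_mem_erase hi, div_eq_mul_inv]
    rw [Finset.sum_congr rfl h, Finset.sum_const, Finset.card_erase_of_mem (Finset.mem_univ _),
      Finset.card_univ, Fintype.card_fin, nsmul_eq_mul, Nat.cast_pred hpos]

/-- `(x/c) log (x/c)` splits even at `x = 0`. -/
theorem div_mul_log_div {c : ℝ} (hc : c ≠ 0) (x : ℝ) :
    x / c * Real.log (x / c) = x / c * (Real.log x - Real.log c) := by
  rcases eq_or_ne x 0 with rfl | hx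
  · simp
  · rw [Real.log_div hx hc]

/-- for `n ≥ 2`, `β ∈ [0,1]`, a standard basis vector `e` and
`v = β·e + (1−β)·uₙ`, the vector `v` is a probability vector and
`log n − H(v) = gₙ(β)`. -/
theorem stmt8 {n : ℕ} (hn : 2 ≤ n) (β : ℝ) (hβ : β ∈ Set.Icc (0 : ℝ) 1) (i₀ : Fin n) :
    probVec (β • (fun i => if i = i₀ then (1 : ℝ) else 0) + (1 - β) • fun _ => (n : ℝ)⁻¹) ∧
    Real.log n -
        ent (β • (fun i => if i = i₀ then (1 : ℝ) else 0) + (1 - β) • fun _ => (n : ℝ)⁻¹) =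
      gfun n β := by
  obtain ⟨h0, h1⟩ := hβ
  have hn0 : (n : ℝ) ≠ 0 := by positivity
  refine ⟨⟨fun i => ?_, ?_⟩, ?_⟩
  · have h1' : 0 ≤ 1 - β := by linarith
    simp only [Pi.add_apply, Pi.smul_apply, smul_eq_mul]
    split_ifs <;> positivity
  · rw [sum_comp_basis_add_uniform (fun x => x)]
    field_simp
    ring
  · rw [ent, sum_comp_basis_add_uniform (fun x => x * Real.log x), gfun]
    simp only [div_mul_log_div hn0]
    field_simp
    ring
end
end

section
/- Let T_α = α·Iₙ + ((1−α)/n)·Eₙ be the n×n Hamming channel with parameter α ∈ [0,1], and let x ∈ [0, log n]. Then the minimum of H(T_α v) over all probability vectors v ∈ Δₙ with H(v) ≥ x is attained at v = β·e + (1−β)·uₙ, where e is any standard basis vector and β ∈ [0,1] is chosen so that H(v) = x (i.e., gₙ(β) = log n − x). -/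
open Matrix BigOperators

noncomputable section

/-- The `n × n` Hamming channel `T_α = α·Iₙ + ((1−α)/n)·Eₙ`. -/
def hammingT (n : ℕ) (α : ℝ) : Matrix (Fin n) (Fin n) ℝ :=
  α • (1 : Matrix (Fin n) (Fin n) ℝ) + ((1 - α) / n) • Matrix.of (fun _ _ => (1 : ℝ))

/-- The Bregman divergence of `t ↦ t log t`. -/
def xlogBregman (t τ : ℝ) : ℝ := t * Real.log t - t * Real.log τ - t + τ

/-- The Bregman divergence of `t ↦ t log t` from the base point `τ`, cut off to `t ≥ τ`. -/
def xlogHinge (t τ : ℝ) : ℝ := if τ ≤ t then xlogBregman t τ else 0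

lemma xlogBregman_self (t : ℝ) : xlogBregman t t = 0 := by
  unfold xlogBregman; ring

lemma xlogBregman_nonneg {t τ : ℝ} (ht : 0 ≤ t) (hτ : 0 < τ) : 0 ≤ xlogBregman t τ := by
  unfold xlogBregman
  rcases ht.eq_or_lt with rfl | ht
  · simpa using hτ.le
  · have h := Real.log_le_sub_one_of_pos (div_pos hτ ht)
    rw [Real.log_div hτ.ne' ht.ne'] at h
    have h2 := mul_le_mul_of_nonneg_left h ht.le
    have h3 : t * (τ / t - 1) = τ - t := by field_simp
    nlinarith

lemma xlogBregman_pos {t τ : ℝ} (ht : 0 < t) (hτ : 0 < τ) (hne : t ≠ τ) :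
    0 < xlogBregman t τ := by
  unfold xlogBregman
  have h1 : τ / t ≠ 1 := fun h => hne ((div_eq_one_iff_eq ht.ne').1 h).symm
  have h := Real.log_lt_sub_one_of_pos (div_pos hτ ht) h1
  rw [Real.log_div hτ.ne' ht.ne'] at h
  have h2 := mul_lt_mul_of_pos_left h ht
  have h3 : t * (τ / t - 1) = τ - t := by field_simp
  nlinarith

/-- The three-point identity of Bregman divergences. -/
lemma xlogBregman_three_point (t s τ : ℝ) :
    xlogBregman t τ =
      xlogBregman t s + xlogBregman s τ + (Real.log s - Real.log τ) * (t - s) := by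
  unfold xlogBregman; ring

lemma xlogBregman_mono {s t τ : ℝ} (hτ : 0 < τ) (hs : τ ≤ s) (hst : s ≤ t) :
    xlogBregman s τ ≤ xlogBregman t τ := by
  have h0 := hτ.trans_le hs
  rw [xlogBregman_three_point t s τ]
  have h1 := xlogBregman_nonneg (h0.le.trans hst) h0
  have h2 := mul_nonneg (sub_nonneg.2 (Real.log_le_log hτ hs)) (sub_nonneg.2 hst)
  linarith

lemma xlogBregman_slope {s t τ : ℝ} (hτ : 0 < τ) (hs : τ ≤ s) (hst : s ≤ t) :
    xlogBregman s τ * (t - τ) ≤ (s - τ) * xlogBregman t τ := by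
  have h0 := hτ.trans_le hs
  have h1 := xlogBregman_nonneg (h0.le.trans hst) h0
  have h2 := xlogBregman_nonneg hτ.le h0
  have h3 : xlogBregman s τ + xlogBregman τ s = (Real.log s - Real.log τ) * (s - τ) := by
    unfold xlogBregman; ring
  rw [xlogBregman_three_point t s τ]
  have h4 := mul_nonneg (sub_nonneg.2 hs) h1
  have h5 := mul_nonneg h2 (sub_nonneg.2 hst)
  linear_combination h4 + h5 + (t - s) * h3

lemma xlogHinge_nonneg {t τ : ℝ} (ht : 0 ≤ t) (hτ : 0 < τ) : 0 ≤ xlogHinge t τ := by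
  unfold xlogHinge
  split_ifs
  exacts [xlogBregman_nonneg ht hτ, le_rfl]

lemma xlogHinge_le_xlogBregman {t τ : ℝ} (ht : 0 ≤ t) (hτ : 0 < τ) :
    xlogHinge t τ ≤ xlogBregman t τ := by
  unfold xlogHinge
  split_ifs
  exacts [le_rfl, xlogBregman_nonneg ht hτ]

lemma xlogBregman_eq_xlogHinge_add (t τ : ℝ) :
    xlogBregman t τ = xlogHinge t τ + xlogBregman (min t τ) τ := by
  unfold xlogHinge
  split_ifs with h
  · rw [min_eq_right h, xlogBregman_self, add_zero]
  · rw [min_eq_left (not_le.1 h).le, zero_add]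

lemma sum_xlogBregman {ι : Type*} [Fintype ι] {v : ι → ℝ} (hv1 : ∑ i, v i = 1) (τ : ℝ) :
    ∑ i, xlogBregman (v i) τ =
      ∑ i, v i * Real.log (v i) - Real.log τ - 1 + Fintype.card ι * τ := by
  simp only [xlogBregman, Finset.sum_add_distrib, Finset.sum_sub_distrib, ← Finset.sum_mul, hv1]
  simp

/-- Superadditivity of the hinge in the excess over its base point. -/
lemma sum_xlogHinge_le {ι : Type*} [Fintype ι] {v : ι → ℝ} {τ : ℝ} (hτ : 0 < τ) :
    ∑ i, xlogHinge (v i) τ ≤ xlogBregman (τ + ∑ i, (v i - min (v i) τ)) τ := by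
  have he : ∀ i, 0 ≤ v i - min (v i) τ := fun i => sub_nonneg.2 (min_le_left _ _)
  set E := ∑ i, (v i - min (v i) τ) with hE
  have hE0 : 0 ≤ E := Finset.sum_nonneg fun i _ => he i
  have hle : ∀ i, v i - min (v i) τ ≤ E := fun i =>
    Finset.single_le_sum (f := fun i => v i - min (v i) τ) (fun i _ => he i) (Finset.mem_univ i)
  rcases hE0.eq_or_lt with h0 | h0
  · rw [← h0, add_zero, xlogBregman_self]
    refine Finset.sum_nonpos fun i _ => ?_
    unfold xlogHinge
    split_ifs with h
    · have := hle i
      rw [min_eq_right h, ← h0] at this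
      rw [show v i = τ by linarith, xlogBregman_self]
    · exact le_rfl
  · have key : ∀ i, xlogHinge (v i) τ * E ≤ (v i - min (v i) τ) * xlogBregman (τ + E) τ := by
      intro i
      unfold xlogHinge
      split_ifs with h
      · have h1 := hle i
        rw [min_eq_right h] at h1 ⊢
        have := xlogBregman_slope hτ h (show v i ≤ τ + E by linarith)
        simpa using this
      · simp [min_eq_left (not_le.1 h).le]
    have hs := Finset.sum_le_sum fun i (_ : i ∈ Finset.univ) => key i
    rw [← Finset.sum_mul, ← Finset.sum_mul, ← hE, mul_comm] at hs
    exact le_of_mul_le_mul_left hs h0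

/-- Among probability vectors `v` with `∑ v log v` bounded by its value at `(q, p, …, p)`, the
latter maximizes the sum of hinges based at any `τ ≤ q`. -/
lemma sum_xlogHinge_le_of_le {ι : Type*} [Fintype ι] {v : ι → ℝ} (hv : ∀ i, 0 ≤ v i)
    (hv1 : ∑ i, v i = 1) {p q : ℝ} (hp : 0 ≤ p) (hpq : p ≤ q)
    (hsum : q + (Fintype.card ι - 1) * p = 1)
    (hG : ∑ i, v i * Real.log (v i) ≤
      q * Real.log q + (Fintype.card ι - 1) * (p * Real.log p))
    {τ : ℝ} (hτ : 0 < τ) (hτq : τ ≤ q) :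
    ∑ i, xlogHinge (v i) τ ≤ xlogHinge q τ + (Fintype.card ι - 1) * xlogHinge p τ := by
  have hD : ∑ i, xlogBregman (v i) τ ≤
      xlogBregman q τ + (Fintype.card ι - 1) * xlogBregman p τ := by
    rw [sum_xlogBregman hv1]
    unfold xlogBregman
    linear_combination hG + (Real.log τ + 1) * hsum
  rcases le_or_gt τ p with hτp | hτp
  · refine (Finset.sum_le_sum fun i _ => xlogHinge_le_xlogBregman (hv i) hτ).trans ?_
    simpa [xlogHinge, hτp, hτq] using hD
  have hp' : xlogHinge p τ = 0 := by simp [xlogHinge, not_le.2 hτp]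
  have hq' : xlogHinge q τ = xlogBregman q τ := by simp [xlogHinge, hτq]
  rw [hp', hq', mul_zero, add_zero]
  by_contra! hlt
  obtain ⟨j, hj⟩ : ∃ j, τ ≤ v j := by
    by_contra! hno
    have : ∑ i, xlogHinge (v i) τ = 0 :=
      Finset.sum_eq_zero fun i _ => by simp [xlogHinge, not_le.2 (hno i)]
    have := xlogBregman_nonneg (hp.trans hpq) hτ
    linarith
  set E := ∑ i, (v i - min (v i) τ) with hE
  have hE0 : 0 ≤ E := Finset.sum_nonneg fun i _ => sub_nonneg.2 (min_le_left _ _)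
  have hmin : ∑ i, min (v i) τ = 1 - E := by
    rw [hE, Finset.sum_sub_distrib, hv1]; ring
  have hM : q < τ + E := by
    by_contra! hle
    have h1 := sum_xlogHinge_le (v := v) hτ
    have h2 := xlogBregman_mono hτ (show τ ≤ τ + E by linarith) hle
    linarith
  have hminj : τ ≤ ∑ i, min (v i) τ := by
    have := Finset.single_le_sum (f := fun i => min (v i) τ)
      (fun i _ => le_min (hv i) hτ.le) (Finset.mem_univ j)
    simpa [min_eq_right hj] using this
  have hp0 : 0 < p := by
    rcases hp.eq_or_lt with h | h
    · rw [← h, mul_zero, add_zero] at hsum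
      linarith
    · exact h
  have h1 := Finset.single_le_sum (f := fun i => xlogBregman (min (v i) τ) p)
    (fun i _ => xlogBregman_nonneg (le_min (hv i) hτ.le) hp0) (Finset.mem_univ j)
  simp only [min_eq_right hj] at h1
  have h2 : ∑ i, xlogBregman (min (v i) τ) τ = ∑ i, xlogBregman (min (v i) τ) p
      + Fintype.card ι * xlogBregman p τ
      + (Real.log p - Real.log τ) * (1 - E - Fintype.card ι * p) := by
    rw [← hmin, Finset.sum_congr rfl fun i _ => xlogBregman_three_point (min (v i) τ) p τ]
    simp only [Finset.sum_add_distrib, ← Finset.mul_sum, Finset.sum_sub_distrib]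
    simp
  have h3 : ∑ i, xlogBregman (v i) τ =
      ∑ i, xlogHinge (v i) τ + ∑ i, xlogBregman (min (v i) τ) τ := by
    rw [← Finset.sum_add_distrib]
    exact Finset.sum_congr rfl fun i _ => xlogBregman_eq_xlogHinge_add _ _
  have h4 : 0 ≤ (Real.log τ - Real.log p) * (τ + E - q) :=
    mul_nonneg (sub_nonneg.2 (Real.log_le_log hp0 hτp.le)) (by linarith)
  have h5 := xlogBregman_three_point τ p τ
  rw [xlogBregman_self] at h5
  have h6 : (Real.log p - Real.log τ) * (1 - E - Fintype.card ι * p) =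
      (Real.log τ - Real.log p) * (τ + E - q) + (Real.log p - Real.log τ) * (τ - p) := by
    linear_combination -(Real.log p - Real.log τ) * hsum
  linarith

lemma sum_xlogHinge_le_of_pos {ι : Type*} [Fintype ι] {v : ι → ℝ} (hv : ∀ i, 0 ≤ v i)
    (hv1 : ∑ i, v i = 1) {p q : ℝ} (hp : 0 ≤ p) (hpq : p ≤ q) (hq : 0 < q)
    (hsum : q + (Fintype.card ι - 1) * p = 1)
    (hG : ∑ i, v i * Real.log (v i) ≤
      q * Real.log q + (Fintype.card ι - 1) * (p * Real.log p))
    {τ : ℝ} (hτ : 0 < τ) :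
    ∑ i, xlogHinge (v i) τ ≤ xlogHinge q τ + (Fintype.card ι - 1) * xlogHinge p τ := by
  rcases le_or_gt τ q with hτq | hτq
  · exact sum_xlogHinge_le_of_le hv hv1 hp hpq hsum hG hτ hτq
  have h0 := sum_xlogHinge_le_of_le hv hv1 hp hpq hsum hG hq le_rfl
  have hqq : xlogHinge q q = 0 := by simp [xlogHinge, xlogBregman_self]
  have hpq' : xlogHinge p q = 0 := by
    unfold xlogHinge
    split_ifs with h
    · rw [le_antisymm hpq h, xlogBregman_self]
    · rfl
  rw [hqq, hpq', mul_zero, add_zero] at h0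
  have hvq : ∀ i, v i ≤ q := by
    intro i
    by_contra! hi
    have h1 := Finset.single_le_sum (f := fun i => xlogHinge (v i) q)
      (fun i _ => xlogHinge_nonneg (hv i) hq) (Finset.mem_univ i)
    have h2 := xlogBregman_pos (hq.trans hi) hq hi.ne'
    simp only [xlogHinge, hi.le, if_true] at h1 h0
    linarith
  have hL : ∑ i, xlogHinge (v i) τ = 0 :=
    Finset.sum_eq_zero fun i _ => by simp [xlogHinge, not_le.2 ((hvq i).trans_lt hτq)]
  rw [hL]
  simp [xlogHinge, not_le.2 hτq, not_le.2 (hpq.trans_lt hτq)]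

lemma intervalIntegrable_mul_xlogBregman {α b : ℝ} (hα : 0 ≤ α) (hb : 0 < b) {t : ℝ}
    (ht : 0 ≤ t) :
    IntervalIntegrable (fun τ => α ^ 2 * b / (α * τ + b) ^ 2 * xlogBregman t τ)
      MeasureTheory.volume 0 t := by
  refine IntervalIntegrable.continuousOn_mul ?_ ?_
  · unfold xlogBregman
    exact ((intervalIntegrable_const.sub
      (intervalIntegral.intervalIntegrable_log'.const_mul t)).sub
      intervalIntegrable_const).add intervalIntegral.intervalIntegrable_id
  · rw [Set.uIcc_of_le ht]
    refine ContinuousOn.div (by fun_prop) (by fun_prop) fun τ hτ => ?_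
    have := mul_nonneg hα hτ.1
    positivity

lemma integral_mul_xlogBregman {α b : ℝ} (hα : 0 ≤ α) (hb : 0 < b) {t : ℝ} (ht : 0 ≤ t) :
    ∫ τ in (0 : ℝ)..t, α ^ 2 * b / (α * τ + b) ^ 2 * xlogBregman t τ =
      (α * t + b) * Real.log (α * t + b) - (b * Real.log b + α * (Real.log b + 1) * t) := by
  have hpos : ∀ τ, 0 ≤ τ → 0 < α * τ + b := fun τ h => by positivity
  have key := intervalIntegral.integral_eq_sub_of_hasDerivAt_of_le
    (f := fun τ => α ^ 2 / (α * τ + b) *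
        (τ * (t * Real.log t) - t * (τ * Real.log τ) - t * τ + τ ^ 2)
      + ((α * τ + b) * Real.log (α * τ + b) + α * (Real.log (α * τ + b) + 1) * (t - τ)))
    ht ?_ ?_ (intervalIntegrable_mul_xlogBregman hα hb ht)
  · rw [key]
    simp only [mul_zero, zero_add]
    ring
  · have hl : ContinuousOn (fun τ => Real.log (α * τ + b)) (Set.Icc 0 t) :=
      ContinuousOn.log (by fun_prop) fun τ hτ => (hpos τ hτ.1).ne'
    have hx : Continuous fun τ : ℝ => τ * Real.log τ := Real.continuous_mul_log
    have hd : ContinuousOn (fun τ => α ^ 2 / (α * τ + b)) (Set.Icc 0 t) :=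
      ContinuousOn.div (by fun_prop) (by fun_prop) fun τ hτ => (hpos τ hτ.1).ne'
    fun_prop
  · intro τ hτ
    have h0 := hτ.1
    have hc := hpos τ h0.le
    have hlin : HasDerivAt (fun τ => α * τ + b) α τ := by
      simpa using ((hasDerivAt_id τ).const_mul α).add_const b
    have hlog := hlin.log hc.ne'
    have hx := (Real.hasDerivAt_mul_log h0.ne')
    have hid := hasDerivAt_id τ
    have hd := (hasDerivAt_const τ (α ^ 2)).div hlin hc.ne'
    have hB := (((hid.mul_const (t * Real.log t)).sub (hx.const_mul t)).sub
      (hid.const_mul t)).add (hid.pow 2)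
    have hR := (hlin.mul hlog).add (((hlog.add_const 1).const_mul α).mul (hid.const_sub t))
    refine ((hd.mul hB).add hR).congr_deriv ?_
    simp only [xlogBregman, id, Pi.add_apply, Pi.sub_apply, Pi.div_apply, Pi.pow_apply]
    field_simp
    ring

lemma xlogHinge_interval {α b : ℝ} (hα : 0 ≤ α) (hb : 0 < b) {t : ℝ} (ht : 0 ≤ t)
    (ht1 : t ≤ 1) :
    IntervalIntegrable (fun τ => α ^ 2 * b / (α * τ + b) ^ 2 * xlogHinge t τ)
      MeasureTheory.volume 0 1 ∧
    ∫ τ in (0 : ℝ)..1, α ^ 2 * b / (α * τ + b) ^ 2 * xlogHinge t τ =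
      (α * t + b) * Real.log (α * t + b) - (b * Real.log b + α * (Real.log b + 1) * t) := by
  have e1 : Set.EqOn (fun τ => α ^ 2 * b / (α * τ + b) ^ 2 * xlogBregman t τ)
      (fun τ => α ^ 2 * b / (α * τ + b) ^ 2 * xlogHinge t τ) (Set.uIoc 0 t) := by
    intro τ hτ
    rw [Set.uIoc_of_le ht] at hτ
    simp [xlogHinge, hτ.2]
  have e2 : Set.EqOn (fun _ => (0 : ℝ))
      (fun τ => α ^ 2 * b / (α * τ + b) ^ 2 * xlogHinge t τ) (Set.uIoc t 1) := by
    intro τ hτ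
    rw [Set.uIoc_of_le ht1] at hτ
    simp [xlogHinge, not_le.2 hτ.1]
  have i1 := (intervalIntegrable_mul_xlogBregman hα hb ht).congr e1
  have i2 := (intervalIntegrable_const (μ := MeasureTheory.volume) (a := t) (b := 1)
    (c := (0 : ℝ))).congr e2
  refine ⟨i1.trans i2, ?_⟩
  rw [← intervalIntegral.integral_add_adjacent_intervals i1 i2,
    ← intervalIntegral.integral_congr_ae (.of_forall e1),
    ← intervalIntegral.integral_congr_ae (.of_forall e2),
    integral_mul_xlogBregman hα hb ht]
  simp

/-- Among probability vectors `v` with `∑ v log v` bounded by its value at `(q, p, …, p)`, the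
latter maximizes `∑ (α v + b) log (α v + b)`. -/
lemma sum_affine_mul_log_le {ι : Type*} [Fintype ι] {v : ι → ℝ} (hv : ∀ i, 0 ≤ v i)
    (hv1 : ∑ i, v i = 1) {p q : ℝ} (hp : 0 ≤ p) (hpq : p ≤ q) (hq : 0 < q) (hq1 : q ≤ 1)
    (hsum : q + (Fintype.card ι - 1) * p = 1)
    (hG : ∑ i, v i * Real.log (v i) ≤
      q * Real.log q + (Fintype.card ι - 1) * (p * Real.log p))
    {α b : ℝ} (hα : 0 ≤ α) (hb : 0 < b) :
    ∑ i, (α * v i + b) * Real.log (α * v i + b) ≤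
      (α * q + b) * Real.log (α * q + b) +
        (Fintype.card ι - 1) * ((α * p + b) * Real.log (α * p + b)) := by
  have hvle : ∀ i, v i ≤ 1 := fun i => by
    rw [← hv1]; exact Finset.single_le_sum (fun i _ => hv i) (Finset.mem_univ i)
  have hI := fun i => xlogHinge_interval hα hb (hv i) (hvle i)
  obtain ⟨qi, qe⟩ := xlogHinge_interval hα hb hq.le hq1
  obtain ⟨pi, pe⟩ := xlogHinge_interval hα hb hp (hpq.trans hq1)
  have hi := IntervalIntegrable.sum Finset.univ fun i _ => (hI i).1
  have hmono := intervalIntegral.integral_mono_on_of_le_Ioo zero_le_one hi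
    (qi.add (pi.const_mul (Fintype.card ι - 1 : ℝ))) fun τ hτ => by
      have h := mul_le_mul_of_nonneg_left
        (sum_xlogHinge_le_of_pos hv hv1 hp hpq hq hsum hG hτ.1)
        (show 0 ≤ α ^ 2 * b / (α * τ + b) ^ 2 by positivity)
      rw [Finset.mul_sum] at h
      simp only [Finset.sum_apply]
      linarith
  rw [intervalIntegral.integral_add qi (pi.const_mul _), intervalIntegral.integral_const_mul,
    qe, pe] at hmono
  simp only [Finset.sum_apply] at hmono
  rw [intervalIntegral.integral_finsetSum fun i _ => (hI i).1,
    Finset.sum_congr rfl fun i _ => (hI i).2, Finset.sum_sub_distrib, Finset.sum_add_distrib,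
    ← Finset.mul_sum _ v, hv1, Finset.sum_const, nsmul_eq_mul, Finset.card_univ] at hmono
  linear_combination hmono - α * (Real.log b + 1) * hsum

lemma sum_ite_eq_add_card_sub_one_mul {n : ℕ} (i₀ : Fin n) (x y : ℝ) :
    ∑ i, (if i = i₀ then x else y) = x + ((n : ℝ) - 1) * y := by
  have h : ∀ i : Fin n, (if i = i₀ then x else y) = (if i = i₀ then x - y else 0) + y := by
    intro i; split_ifs <;> ring
  simp only [h, Finset.sum_add_distrib]
  simp
  ring

lemma hammingT_mulVec {n : ℕ} (α : ℝ) {v : Fin n → ℝ} (hv : ∑ i, v i = 1) (i : Fin n) :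
    (hammingT n α).mulVec v i = α * v i + (1 - α) / n := by
  simp [hammingT, Matrix.mulVec, dotProduct, Matrix.one_apply, add_mul, Finset.sum_add_distrib,
    ← Finset.mul_sum, hv]

/-- for the Hamming channel `T_α` and `x ∈ [0, log n]`, the minimum of
`H(T_α v)` over probability vectors `v` with `H(v) ≥ x` is attained at
`v = β·e + (1−β)·uₙ`, where `e` is any standard basis vector and `β ∈ [0,1]` is such
that `H(v) = x`. -/
theorem stmt10 {n : ℕ} (hn : 2 ≤ n) (α : ℝ) (hα : α ∈ Set.Icc (0 : ℝ) 1)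
    (x : ℝ) (hx : x ∈ Set.Icc 0 (Real.log n)) (i₀ : Fin n)
    (β : ℝ) (hβ : β ∈ Set.Icc (0 : ℝ) 1)
    (hβx :
      ent (β • (fun i => if i = i₀ then (1 : ℝ) else 0) + (1 - β) • fun _ => (n : ℝ)⁻¹) = x) :
    probVec (β • (fun i => if i = i₀ then (1 : ℝ) else 0) + (1 - β) • fun _ => (n : ℝ)⁻¹) ∧
    x ≤ ent (β • (fun i => if i = i₀ then (1 : ℝ) else 0) + (1 - β) • fun _ => (n : ℝ)⁻¹) ∧
    ∀ v' : Fin n → ℝ, probVec v' → x ≤ ent v' →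
      ent ((hammingT n α).mulVec
          (β • (fun i => if i = i₀ then (1 : ℝ) else 0) + (1 - β) • fun _ => (n : ℝ)⁻¹)) ≤
        ent ((hammingT n α).mulVec v') := by
  have hn0 : (0 : ℝ) < n := by exact_mod_cast (by omega : 0 < n)
  obtain ⟨hβ0, hβ1⟩ := hβ
  obtain ⟨hα0, hα1⟩ := hα
  set p : ℝ := (1 - β) * (n : ℝ)⁻¹ with hp
  set q : ℝ := β + p with hq
  have hw : (β • (fun i => if i = i₀ then (1 : ℝ) else 0) + (1 - β) • fun _ => (n : ℝ)⁻¹) =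
      fun i : Fin n => if i = i₀ then q else p := by
    funext i
    by_cases h : i = i₀ <;> simp [h, hq, hp]
  have hp0 : 0 ≤ p := mul_nonneg (by linarith) (inv_nonneg.2 hn0.le)
  have hsum : q + ((n : ℝ) - 1) * p = 1 := by
    rw [hq, hp]; field_simp; ring
  have hsumw : ∑ i : Fin n, (if i = i₀ then q else p) = 1 := by
    rw [sum_ite_eq_add_card_sub_one_mul, hsum]
  rw [hw] at hβx ⊢
  refine ⟨⟨fun i => ?_, hsumw⟩, hβx.ge, ?_⟩
  · dsimp only
    split_ifs <;> linarith
  rintro v ⟨hv, hv1⟩ hxv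
  rw [← hβx] at hxv
  rcases hα1.eq_or_lt with rfl | hα1
  · have h1 : hammingT n 1 = 1 := by simp [hammingT]
    simpa [h1] using hxv
  have hent : ∀ g : ℝ → ℝ, ∑ i : Fin n, g (if i = i₀ then q else p) =
      g q + ((n : ℝ) - 1) * g p := fun g => by
    simp only [apply_ite g]
    exact sum_ite_eq_add_card_sub_one_mul i₀ _ _
  have hq0 : 0 < q := by
    rcases hβ0.eq_or_lt with h | h
    · rw [hq, hp, ← h]; simpa using hn0
    · linarith
  have hn1 : (1 : ℝ) ≤ n := by exact_mod_cast (by omega : 1 ≤ n)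
  have hq1 : q ≤ 1 := by
    have := mul_nonneg (sub_nonneg.2 hn1) hp0
    linarith
  unfold ent at hxv ⊢
  rw [hent fun t => t * Real.log t] at hxv
  simp only [hammingT_mulVec α hv1, hammingT_mulVec α hsumw]
  rw [hent fun t => (α * t + (1 - α) / n) * Real.log (α * t + (1 - α) / n)]
  have := sum_affine_mul_log_le hv hv1 hp0 (by linarith) hq0 hq1 (by simpa using hsum)
    (by simpa using hxv) hα0 (div_pos (sub_pos.2 hα1) hn0)
  simpa using this
end
end

section
/- Let z ∈ Δₘ, let G_m be the m×m reversal permutation matrix, and let T = [z, G_m z] be the m×2 column-stochastic matrix of a binary memoryless symmetric channel. For every x ∈ [0, log 2], the minimum of Σ_i w_i·H(T p_i) over all finite decompositions u₂ = Σ_i w_i·p_i of the uniform binary vector satisfying Σ_i w_i·H(p_i) ≥ x equals min { H(a·z + (1−a)·G_m z) : a ∈ [0,1], h_b(a) ≥ x }, where h_b(a) = −a log a − (1−a) log(1−a); moreover the minimum is attained with two components (a, 1−a) and (1−a, a) with weights 1/2 each. That is, a binary symmetric test channel from X to W maximizes I(W;Y). -/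
open Matrix BigOperators

noncomputable section

/-- Binary entropy function. -/
def hb (a : ℝ) : ℝ := -(a * Real.log a) - (1 - a) * Real.log (1 - a)

/-- The `m × 2` transition matrix `T = [z, G_m z]` of a binary memoryless
symmetric channel, `G_m` being the reversal permutation. -/
def bmsMatrix {m : ℕ} (z : Fin m → ℝ) : Matrix (Fin m) (Fin 2) ℝ :=
  fun j i => if i = 0 then z j else z j.rev

/-- The function `log (1 + t) - log (1 - t)`, twice the inverse hyperbolic tangent on `(-1, 1)`. -/
def logOdds (t : ℝ) : ℝ := Real.log (1 + t) - Real.log (1 - t)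

/-- The binary entropy as a function of the bias `t = 1 - 2 * a`. -/
def biasEntropy (t : ℝ) : ℝ := Real.binEntropy ((1 - t) / 2)

lemma hb_eq_binEntropy (a : ℝ) : hb a = Real.binEntropy a := by
  simp only [hb, Real.binEntropy, Real.log_inv]
  ring

lemma biasEntropy_one_sub_two_mul (a : ℝ) : biasEntropy (1 - 2 * a) = hb a := by
  rw [hb_eq_binEntropy, biasEntropy]
  ring_nf

lemma biasEntropy_neg (t : ℝ) : biasEntropy (-t) = biasEntropy t := by
  rw [biasEntropy, biasEntropy, ← Real.binEntropy_one_sub]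
  ring_nf

lemma biasEntropy_abs (t : ℝ) : biasEntropy |t| = biasEntropy t := by
  rcases abs_choice t with h | h <;> rw [h]
  exact biasEntropy_neg t

lemma continuous_biasEntropy : Continuous biasEntropy :=
  Real.binEntropy_continuous.comp (by fun_prop)

lemma hasDerivAt_logOdds {t : ℝ} (h₁ : -1 < t) (h₂ : t < 1) :
    HasDerivAt logOdds (2 / (1 - t ^ 2)) t := by
  have ha : 1 + t ≠ 0 := by linarith
  have hb : 1 - t ≠ 0 := by linarith
  have h : HasDerivAt logOdds _ t :=
    (((hasDerivAt_id t).const_add 1).log ha).sub (((hasDerivAt_id t).const_sub 1).log hb)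
  convert h using 1
  have hc : 1 - t ^ 2 ≠ 0 := by
    rw [show 1 - t ^ 2 = (1 + t) * (1 - t) by ring]
    exact mul_ne_zero ha hb
  simp only [id]
  field_simp
  ring

lemma hasDerivAt_biasEntropy {t : ℝ} (h₁ : -1 < t) (h₂ : t < 1) :
    HasDerivAt biasEntropy (-(logOdds t / 2)) t := by
  have h : HasDerivAt biasEntropy _ t :=
    (Real.hasDerivAt_binEntropy (p := (1 - t) / 2) (by linarith) (by linarith)).comp t
      (((hasDerivAt_id t).const_sub 1).div_const 2)
  convert h using 1
  rw [show 1 - (1 - t) / 2 = (1 + t) / 2 by ring, Real.log_div (by linarith) two_ne_zero,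
    Real.log_div (by linarith) two_ne_zero, logOdds]
  ring

lemma logOdds_zero : logOdds 0 = 0 := by simp [logOdds]

/-- Any function with nonnegative derivative on `(a, b)`, continuous on `[a, b]`, is monotone. -/
lemma monotoneOn_Icc_of_hasDerivAt {f f' : ℝ → ℝ} {a b : ℝ} (hf : ContinuousOn f (Set.Icc a b))
    (hd : ∀ t ∈ Set.Ioo a b, HasDerivAt f (f' t) t) (h : ∀ t ∈ Set.Ioo a b, 0 ≤ f' t) :
    MonotoneOn f (Set.Icc a b) := by
  refine monotoneOn_of_hasDerivWithinAt_nonneg (f' := f') (convex_Icc a b) hf ?_ ?_ <;>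
    rw [interior_Icc]
  · exact fun t ht => (hd t ht).hasDerivWithinAt
  · exact h

lemma two_mul_le_logOdds {t : ℝ} (h₀ : 0 ≤ t) (h₁ : t < 1) : 2 * t ≤ logOdds t := by
  have hd : ∀ s ∈ Set.Icc 0 t, HasDerivAt (fun s => logOdds s - 2 * s)
      (2 / (1 - s ^ 2) - 2 * 1) s := fun s hs =>
    (hasDerivAt_logOdds (by linarith [hs.1]) (by linarith [hs.2])).sub
      ((hasDerivAt_id s).const_mul 2)
  have hm := monotoneOn_Icc_of_hasDerivAt
    (fun s hs => (hd s hs).continuousAt.continuousWithinAt)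
    (fun s hs => hd s (Set.Ioo_subset_Icc_self hs)) (fun s hs => by
      have : 0 < 1 - s ^ 2 := by nlinarith [hs.1, hs.2]
      rw [sub_nonneg, le_div_iff₀ this]
      nlinarith [sq_nonneg s]) (Set.left_mem_Icc.2 h₀) (Set.right_mem_Icc.2 h₀) h₀
  simp only [logOdds_zero] at hm
  linarith

lemma logOdds_nonneg {t : ℝ} (h₀ : 0 ≤ t) (h₁ : t < 1) : 0 ≤ logOdds t := by
  linarith [two_mul_le_logOdds h₀ h₁]

lemma hasDerivAt_logOdds_mul {r t : ℝ} (hr : 0 ≤ r) (hr₁ : r ≤ 1) (h₀ : 0 ≤ t) (h₁ : t < 1) :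
    HasDerivAt (fun s => logOdds (r * s)) (2 / (1 - (r * t) ^ 2) * r) t := by
  have hd : HasDerivAt (fun s => r * s) r t := by
    simpa using (hasDerivAt_id t).const_mul r
  exact (hasDerivAt_logOdds (by nlinarith) (by nlinarith)).comp t hd

lemma logOdds_mul_le {r t : ℝ} (hr : 0 ≤ r) (hr₁ : r ≤ 1) (h₀ : 0 ≤ t) (h₁ : t < 1) :
    logOdds (r * t) ≤ r * logOdds t := by
  have hd : ∀ s ∈ Set.Icc 0 t, HasDerivAt (fun s => r * logOdds s - logOdds (r * s))
      (r * (2 / (1 - s ^ 2)) - 2 / (1 - (r * s) ^ 2) * r) s := fun s hs =>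
    ((hasDerivAt_logOdds (by linarith [hs.1]) (by linarith [hs.2])).const_mul r).sub
      (hasDerivAt_logOdds_mul hr hr₁ hs.1 (hs.2.trans_lt h₁))
  have hm := monotoneOn_Icc_of_hasDerivAt
    (fun s hs => (hd s hs).continuousAt.continuousWithinAt)
    (fun s hs => hd s (Set.Ioo_subset_Icc_self hs)) (fun s hs => by
      have hs₁ : 0 < 1 - s ^ 2 := by nlinarith [hs.1, hs.2]
      have hs₂ : (r * s) ^ 2 ≤ s ^ 2 :=
        pow_le_pow_left₀ (mul_nonneg hr hs.1.le) (mul_le_of_le_one_left hs.1.le hr₁) 2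
      rw [sub_nonneg, mul_comm r (2 / _)]
      refine mul_le_mul_of_nonneg_right (div_le_div_of_nonneg_left zero_le_two hs₁ ?_) hr
      linarith) (Set.left_mem_Icc.2 h₀) (Set.right_mem_Icc.2 h₀) h₀
  simp only [mul_zero, logOdds_zero, sub_zero] at hm
  linarith

lemma antitoneOn_one_sub_sq_mul_logOdds_div :
    AntitoneOn (fun t => (1 - t ^ 2) * logOdds t / t) (Set.Ioo 0 1) := by
  have hd : ∀ t ∈ Set.Ioo (0 : ℝ) 1, HasDerivAt (fun t => (1 - t ^ 2) * logOdds t / t)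
      ((2 * t - (1 + t ^ 2) * logOdds t) / t ^ 2) t := fun t ht => by
    have hp : HasDerivAt (fun t : ℝ => 1 - t ^ 2) (-(2 * t)) t := by
      simpa using (hasDerivAt_pow 2 t).const_sub 1
    have hq : HasDerivAt (fun t => (1 - t ^ 2) * logOdds t / t) _ t :=
      (hp.mul (hasDerivAt_logOdds (by linarith [ht.1]) ht.2)).div (hasDerivAt_id t) ht.1.ne'
    convert hq using 1
    have h₁ : 1 - t ^ 2 ≠ 0 := by nlinarith [ht.1, ht.2]
    have h₂ := ht.1.ne'
    simp only [Pi.mul_apply]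
    field_simp
    ring
  refine antitoneOn_of_hasDerivWithinAt_nonpos (convex_Ioo 0 1)
    (fun t ht => (hd t ht).continuousAt.continuousWithinAt)
    (fun t ht => (hd t (interior_subset ht)).hasDerivWithinAt) fun t ht => ?_
  have ht := interior_subset ht
  have hL := two_mul_le_logOdds ht.1.le ht.2
  refine div_nonpos_of_nonpos_of_nonneg ?_ (sq_nonneg t)
  nlinarith [sq_nonneg t, ht.1, mul_nonneg (sq_nonneg t) (logOdds_nonneg ht.1.le ht.2)]

lemma antitoneOn_logOdds_mul_div {r : ℝ} (hr : 0 < r) (hr₁ : r ≤ 1) :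
    AntitoneOn (fun t => logOdds (r * t) / logOdds t) (Set.Ioo 0 1) := by
  have hpos : ∀ t ∈ Set.Ioo (0 : ℝ) 1, 0 < logOdds t := fun t ht => by
    linarith [two_mul_le_logOdds ht.1.le ht.2, ht.1]
  have hd : ∀ t ∈ Set.Ioo (0 : ℝ) 1, HasDerivAt (fun t => logOdds (r * t) / logOdds t) _ t :=
    fun t ht => (hasDerivAt_logOdds_mul hr.le hr₁ ht.1.le ht.2).div
      (hasDerivAt_logOdds (by linarith [ht.1]) ht.2) (hpos t ht).ne'
  refine antitoneOn_of_hasDerivWithinAt_nonpos (convex_Ioo 0 1)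
    (fun t ht => (hd t ht).continuousAt.continuousWithinAt)
    (fun t ht => (hd t (interior_subset ht)).hasDerivWithinAt) fun t ht => ?_
  have ht := interior_subset ht
  refine div_nonpos_of_nonpos_of_nonneg ?_ (sq_nonneg _)
  have hrt : r * t ≤ t := mul_le_of_le_one_left ht.1.le hr₁
  have hrt₀ : 0 < r * t := mul_pos hr ht.1
  have key := antitoneOn_one_sub_sq_mul_logOdds_div ⟨hrt₀, hrt.trans_lt ht.2⟩ ht hrt
  have h₁ : 0 < 1 - t ^ 2 := by nlinarith [ht.1, ht.2]
  have h₂ : 0 < 1 - (r * t) ^ 2 := by nlinarith [ht.1, ht.2]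
  simp only at key
  rw [div_le_div_iff₀ ht.1 hrt₀] at key
  have key' : (1 - t ^ 2) * logOdds t * r ≤ (1 - (r * t) ^ 2) * logOdds (r * t) := by
    refine le_of_mul_le_mul_right ?_ ht.1
    linarith
  rw [sub_nonpos, div_mul_eq_mul_div, div_mul_eq_mul_div, mul_div_assoc', div_le_div_iff₀ h₂ h₁]
  linarith

lemma logOdds_mul_mul_le {r s t : ℝ} (hr : 0 ≤ r) (hr₁ : r ≤ 1) (hs : 0 < s) (hst : s ≤ t)
    (ht : t < 1) : logOdds (r * t) * logOdds s ≤ logOdds (r * s) * logOdds t := by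
  rcases hr.eq_or_lt with rfl | hr
  · simp [logOdds_zero]
  have hs₁ := hst.trans_lt ht
  have h := antitoneOn_logOdds_mul_div hr hr₁ ⟨hs, hs₁⟩ ⟨hs.trans_le hst, ht⟩ hst
  have h₁ := two_mul_le_logOdds hs.le hs₁
  have h₂ := two_mul_le_logOdds (hs.le.trans hst) ht
  exact (div_le_div_iff₀ (by linarith) (by linarith)).1 h

/-- Local form of Mrs. Gerber's lemma: for `0 ≤ r ≤ 1`, the curve
`t ↦ (biasEntropy t, biasEntropy (r * t))` has a supporting line of nonnegative slope. -/
lemma exists_slope_biasEntropy_of_nonneg {r t₀ : ℝ} (hr : 0 ≤ r) (hr₁ : r ≤ 1) (ht₀ : 0 ≤ t₀)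
    (ht₁ : t₀ ≤ 1) : ∃ c, 0 ≤ c ∧ ∀ t ∈ Set.Icc (0 : ℝ) 1,
      biasEntropy (r * t₀) + c * (biasEntropy t - biasEntropy t₀) ≤ biasEntropy (r * t) := by
  suffices h : ∃ c, 0 ≤ c ∧ (∀ t ∈ Set.Ioo 0 t₀, c * logOdds t ≤ r * logOdds (r * t)) ∧
      ∀ t ∈ Set.Ioo t₀ 1, r * logOdds (r * t) ≤ c * logOdds t by
    obtain ⟨c, hc, hl, hu⟩ := h
    refine ⟨c, hc, fun t ht => ?_⟩
    have hd : ∀ t ∈ Set.Ioo (0 : ℝ) 1, HasDerivAt (fun t => biasEntropy (r * t) - c * biasEntropy t)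
        ((c * logOdds t - r * logOdds (r * t)) / 2) t := fun t ht => by
      have hm : HasDerivAt (fun s => r * s) r t := by
        simpa using (hasDerivAt_id t).const_mul r
      have h₁ := mul_nonneg hr ht.1.le
      have h₂ := mul_le_of_le_one_left ht.1.le hr₁
      have hq : HasDerivAt (fun t => biasEntropy (r * t) - c * biasEntropy t) _ t :=
        ((hasDerivAt_biasEntropy (t := r * t) (by linarith) (by linarith [ht.2])).comp t
          hm).sub ((hasDerivAt_biasEntropy (by linarith [ht.1]) ht.2).const_mul c)
      convert hq using 1
      ring
    have hcont : Continuous fun t => biasEntropy (r * t) - c * biasEntropy t := by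
      have := continuous_biasEntropy
      fun_prop
    rcases le_total t₀ t with h | h
    · have := monotoneOn_Icc_of_hasDerivAt (a := t₀) (b := 1) hcont.continuousOn
        (fun s hs => hd s ⟨ht₀.trans_lt hs.1, hs.2⟩)
        (fun s hs => by linarith [hu s hs]) ⟨le_rfl, ht₁⟩ ⟨h, ht.2⟩ h
      linarith
    · have := monotoneOn_Icc_of_hasDerivAt (a := 0) (b := t₀) hcont.neg.continuousOn
        (fun s hs => (hd s ⟨hs.1, hs.2.trans_le ht₁⟩).neg)
        (fun s hs => by linarith [hl s hs]) ⟨ht.1, h⟩ ⟨ht₀, le_rfl⟩ h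
      simp only [Pi.neg_apply] at this
      linarith
  rcases ht₀.eq_or_lt with rfl | ht₀
  · refine ⟨r * r, mul_nonneg hr hr, by simp, fun t ht => ?_⟩
    rw [mul_assoc]
    exact mul_le_mul_of_nonneg_left (logOdds_mul_le hr hr₁ ht.1.le ht.2) hr
  rcases ht₁.eq_or_lt with rfl | ht₁
  · refine ⟨0, le_rfl, fun t ht => ?_, by simp⟩
    rw [zero_mul]
    exact mul_nonneg hr (logOdds_nonneg (mul_nonneg hr ht.1.le)
      ((mul_le_of_le_one_left ht.1.le hr₁).trans_lt ht.2))
  have hL : 0 < logOdds t₀ := by linarith [two_mul_le_logOdds ht₀.le ht₁]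
  refine ⟨r * (logOdds (r * t₀) / logOdds t₀), mul_nonneg hr (div_nonneg (logOdds_nonneg
    (mul_nonneg hr ht₀.le) ((mul_le_of_le_one_left ht₀.le hr₁).trans_lt ht₁)) hL.le),
    fun t ht => ?_, fun t ht => ?_⟩ <;> rw [mul_assoc] <;>
    refine mul_le_mul_of_nonneg_left ?_ hr <;> rw [div_mul_eq_mul_div]
  · rw [div_le_iff₀ hL]
    exact logOdds_mul_mul_le hr hr₁ ht.1 ht.2.le ht₁
  · rw [le_div_iff₀ hL]
    exact logOdds_mul_mul_le hr hr₁ ht₀ ht.1.le ht.2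

lemma exists_slope_biasEntropy {r t₀ : ℝ} (hr : |r| ≤ 1) (ht₀ : |t₀| ≤ 1) :
    ∃ c, 0 ≤ c ∧ ∀ t, |t| ≤ 1 →
      biasEntropy (r * t₀) + c * (biasEntropy t - biasEntropy t₀) ≤ biasEntropy (r * t) := by
  obtain ⟨c, hc, h⟩ := exists_slope_biasEntropy_of_nonneg (abs_nonneg r) hr (abs_nonneg t₀) ht₀
  refine ⟨c, hc, fun t ht => ?_⟩
  simpa only [← abs_mul, biasEntropy_abs] using h |t| ⟨abs_nonneg t, ht⟩

open Real in
lemma negMulLog_add_negMulLog {u v : ℝ} (h : u + v ≠ 0) :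
    negMulLog u + negMulLog v =
      negMulLog (u + v) + (u + v) * biasEntropy ((v - u) / (u + v)) := by
  have hu : (u + v) * (u / (u + v)) = u := by field_simp
  have hv : (u + v) * (v / (u + v)) = v := by field_simp
  have hs : u / (u + v) + v / (u + v) = 1 := by field_simp
  have hy : (1 - (v - u) / (u + v)) / 2 = u / (u + v) := by field_simp; ring
  have hy' : 1 - u / (u + v) = v / (u + v) := by linarith
  rw [biasEntropy, hy, binEntropy_eq_negMulLog_add_negMulLog_one_sub, hy']
  have h₁ := negMulLog_mul (u + v) (u / (u + v))
  have h₂ := negMulLog_mul (u + v) (v / (u + v))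
  rw [hu] at h₁
  rw [hv] at h₂
  rw [h₁, h₂]
  linear_combination negMulLog (u + v) * hs

open Real in
lemma exists_slope_negMulLog_pair {u v a₀ : ℝ} (hu : 0 ≤ u) (hv : 0 ≤ v)
    (ha₀ : a₀ ∈ Set.Icc (0 : ℝ) 1) : ∃ c, 0 ≤ c ∧ ∀ a ∈ Set.Icc (0 : ℝ) 1,
      negMulLog (a₀ * u + (1 - a₀) * v) + negMulLog (a₀ * v + (1 - a₀) * u) + c * (hb a - hb a₀) ≤
        negMulLog (a * u + (1 - a) * v) + negMulLog (a * v + (1 - a) * u) := by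
  rcases (add_nonneg hu hv).eq_or_lt with h | h
  · obtain ⟨rfl, rfl⟩ : u = 0 ∧ v = 0 := ⟨by linarith, by linarith⟩
    exact ⟨0, le_rfl, by simp⟩
  have habs : ∀ a ∈ Set.Icc (0 : ℝ) 1, |1 - 2 * a| ≤ 1 := fun a ha =>
    abs_le.2 ⟨by linarith [ha.2], by linarith [ha.1]⟩
  have hr : |(u - v) / (u + v)| ≤ 1 := by
    rw [abs_div, abs_of_pos h, div_le_one h]
    exact abs_le.2 ⟨by linarith, by linarith⟩
  obtain ⟨c, hc, H⟩ := exists_slope_biasEntropy hr (habs a₀ ha₀)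
  have hpair : ∀ a, negMulLog (a * u + (1 - a) * v) + negMulLog (a * v + (1 - a) * u) =
      negMulLog (u + v) + (u + v) * biasEntropy ((u - v) / (u + v) * (1 - 2 * a)) := fun a => by
    have hs : a * u + (1 - a) * v + (a * v + (1 - a) * u) = u + v := by ring
    rw [negMulLog_add_negMulLog (hs ▸ h.ne'), hs]
    congr 3
    ring
  refine ⟨(u + v) * c, mul_nonneg h.le hc, fun a ha => ?_⟩
  have := mul_le_mul_of_nonneg_left (H _ (habs a ha)) h.le
  rw [biasEntropy_one_sub_two_mul, biasEntropy_one_sub_two_mul] at this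
  rw [hpair, hpair]
  linarith

lemma ent_eq_sum_negMulLog {n : ℕ} (p : Fin n → ℝ) : ent p = ∑ i, Real.negMulLog (p i) := by
  simp [ent, Real.negMulLog]

lemma ent_binary {p : Fin 2 → ℝ} (hp : p 0 + p 1 = 1) : ent p = hb (p 0) := by
  rw [ent, hb, Fin.sum_univ_two, show p 1 = 1 - p 0 by linarith]
  ring

lemma bmsMatrix_mulVec {m : ℕ} (z : Fin m → ℝ) {p : Fin 2 → ℝ} (hp : p 0 + p 1 = 1) :
    (bmsMatrix z).mulVec p = fun j => p 0 * z j + (1 - p 0) * z j.rev := by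
  ext j
  simp only [Matrix.mulVec, dotProduct, bmsMatrix, Fin.sum_univ_two]
  rw [show 1 - p 0 = p 1 by linarith]
  simp [mul_comm]

lemma ent_comp_rev {m : ℕ} (p : Fin m → ℝ) : ent (fun j => p j.rev) = ent p := by
  simp only [ent_eq_sum_negMulLog]
  exact Equiv.sum_comp Fin.revPerm fun j => Real.negMulLog (p j)

lemma two_mul_ent_mix_rev {m : ℕ} (z : Fin m → ℝ) (a : ℝ) :
    2 * ent (fun j => a * z j + (1 - a) * z j.rev) =
      ∑ j, (Real.negMulLog (a * z j + (1 - a) * z j.rev) +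
        Real.negMulLog (a * z j.rev + (1 - a) * z j)) := by
  have h := ent_comp_rev fun j => a * z j + (1 - a) * z j.rev
  simp only [Fin.rev_rev] at h
  rw [two_mul, Finset.sum_add_distrib, ← ent_eq_sum_negMulLog, ← ent_eq_sum_negMulLog, h]

/-- The output entropy of a binary memoryless symmetric channel, as a function of the input
entropy, has supporting lines of nonnegative slope. -/
lemma exists_slope_ent_mix_rev {m : ℕ} {z : Fin m → ℝ} (hz : ∀ j, 0 ≤ z j) {a₀ : ℝ}
    (ha₀ : a₀ ∈ Set.Icc (0 : ℝ) 1) : ∃ c, 0 ≤ c ∧ ∀ a ∈ Set.Icc (0 : ℝ) 1,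
      ent (fun j => a₀ * z j + (1 - a₀) * z j.rev) + c * (hb a - hb a₀) ≤
        ent (fun j => a * z j + (1 - a) * z j.rev) := by
  choose c hc h using fun j => exists_slope_negMulLog_pair (hz j) (hz j.rev) ha₀
  refine ⟨(∑ j, c j) / 2, div_nonneg (Finset.sum_nonneg fun j _ => hc j) zero_le_two,
    fun a ha => ?_⟩
  have := Finset.sum_le_sum fun j (_ : j ∈ Finset.univ) => h j a ha
  rw [Finset.sum_add_distrib, ← Finset.sum_mul, ← two_mul_ent_mix_rev, ← two_mul_ent_mix_rev]
    at this
  linarith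

lemma exists_hb_eq {x : ℝ} (hx : x ∈ Set.Icc 0 (Real.log 2)) :
    ∃ a ∈ Set.Icc (0 : ℝ) 1, hb a = x := by
  have h := intermediate_value_Icc (show (0 : ℝ) ≤ 2⁻¹ by norm_num)
    Real.binEntropy_continuous.continuousOn
  rw [Real.binEntropy_zero, Real.binEntropy_two_inv] at h
  obtain ⟨a, ha, hax⟩ := h hx
  exact ⟨a, ⟨ha.1, ha.2.trans (by norm_num)⟩, by rw [hb_eq_binEntropy, hax]⟩

/-- for a BMS channel `T = [z, G_m z]` and `x ∈ [0, log 2]`, the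
minimum of `Σ_i w_i·H(T p_i)` over finite decompositions `u₂ = Σ_i w_i·p_i` with
`Σ_i w_i·H(p_i) ≥ x` equals `min { H(a·z + (1−a)·G_m z) : a ∈ [0,1], h_b(a) ≥ x }`,
and it is attained with the two components `(a, 1−a)` and `(1−a, a)`, weights `1/2`
each (a binary symmetric test channel). -/
theorem stmt13 {m : ℕ} (z : Fin m → ℝ) (hz : probVec z)
    (x : ℝ) (hx : x ∈ Set.Icc 0 (Real.log 2)) :
    ∃ a : ℝ, a ∈ Set.Icc (0 : ℝ) 1 ∧ x ≤ hb a ∧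
      (∀ a' : ℝ, a' ∈ Set.Icc (0 : ℝ) 1 → x ≤ hb a' →
        ent (fun j => a * z j + (1 - a) * z j.rev) ≤
          ent (fun j => a' * z j + (1 - a') * z j.rev)) ∧
      (∀ (k : ℕ) (w : Fin k → ℝ) (p : Fin k → Fin 2 → ℝ),
        probVec w → (∀ i, probVec (p i)) →
        (∑ i, w i • p i) = (fun _ : Fin 2 => (2 : ℝ)⁻¹) →
        x ≤ ∑ i, w i * ent (p i) →
        ent (fun j => a * z j + (1 - a) * z j.rev) ≤
          ∑ i, w i * ent ((bmsMatrix z).mulVec (p i))) ∧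
      ((2 : ℝ)⁻¹ • ![a, 1 - a] + (2 : ℝ)⁻¹ • ![1 - a, a]) = (fun _ : Fin 2 => (2 : ℝ)⁻¹) ∧
      x ≤ (2 : ℝ)⁻¹ * ent ![a, 1 - a] + (2 : ℝ)⁻¹ * ent ![1 - a, a] ∧
      (2 : ℝ)⁻¹ * ent ((bmsMatrix z).mulVec ![a, 1 - a]) +
          (2 : ℝ)⁻¹ * ent ((bmsMatrix z).mulVec ![1 - a, a]) =
        ent (fun j => a * z j + (1 - a) * z j.rev) := by
  obtain ⟨a, ha, hax⟩ := exists_hb_eq hx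
  obtain ⟨c, hc, h⟩ := exists_slope_ent_mix_rev hz.1 ha
  have hsum : ![a, 1 - a] 0 + ![a, 1 - a] 1 = 1 := by simp
  have hsum' : ![1 - a, a] 0 + ![1 - a, a] 1 = 1 := by simp
  refine ⟨a, ha, hax.ge, fun a' ha' hx' => ?_, fun k w p hw hp _ hxp => ?_, ?_, ?_, ?_⟩
  · have := h a' ha'
    have := mul_nonneg hc (sub_nonneg.2 (hax.le.trans hx'))
    linarith
  · have hp₁ : ∀ i, p i 0 + p i 1 = 1 := fun i => by
      rw [← Fin.sum_univ_two, (hp i).2]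
    have hmem : ∀ i, p i 0 ∈ Set.Icc (0 : ℝ) 1 := fun i =>
      ⟨(hp i).1 0, by linarith [hp₁ i, (hp i).1 1]⟩
    have hle := Finset.sum_le_sum fun i (_ : i ∈ Finset.univ) =>
      mul_le_mul_of_nonneg_left (h (p i 0) (hmem i)) (hw.1 i)
    simp only [ent_binary (hp₁ _)] at hxp
    simp only [bmsMatrix_mulVec z (hp₁ _)]
    refine le_trans ?_ hle
    set e := ent fun j => a * z j + (1 - a) * z j.rev
    have hexp : ∑ i, w i * (e + c * (hb (p i 0) - hb a)) =
        (∑ i, w i) * (e - c * hb a) + c * ∑ i, w i * hb (p i 0) := by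
      rw [Finset.sum_mul, Finset.mul_sum, ← Finset.sum_add_distrib]
      exact Finset.sum_congr rfl fun i _ => by ring
    rw [hexp, hw.2, hax]
    have := mul_le_mul_of_nonneg_left hxp hc
    linarith
  · ext i
    fin_cases i <;> simp <;> ring
  · rw [ent_binary hsum, ent_binary hsum']
    have : hb (1 - a) = hb a := by simp [hb]; ring
    simp only [Matrix.cons_val_zero, this]
    linarith
  · rw [bmsMatrix_mulVec z hsum, bmsMatrix_mulVec z hsum']
    have := ent_comp_rev fun j => a * z j + (1 - a) * z j.rev
    simp only [Fin.rev_rev] at this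
    simp only [Matrix.cons_val_zero, sub_sub_cancel]
    rw [← this]
    simp only [add_comm]
    rw [← two_mul, ← mul_assoc]
    norm_num [this]
end
end
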